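/- arXiv:1002.0362 — 2 statements merged into one kernel-verified Lean document; each statement's English description precedes it below -/
import Mathlib

section
/- For every integer M ≥ 11, every positive integer k, and every complex number s with q_M·k + (M+1)·log 3 ≤ Re(s) ≤ q_{M−1}·k − M·log 3, the k-th derivative of the Riemann zeta function does not vanish at s, i.e. iteratedDeriv k riemannZeta s ≠ 0. -/
/-- `q M = log(log M / log(M+1)) / log(M/(M+1))`, the slope of the `M`-th critical line. -/
noncomputable def q (M : ℕ) : ℝ :=
  Real.log (Real.log M / Real.log ((M : ℝ) + 1)) / Real.log ((M : ℝ) / ((M : ℝ) + 1))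

lemma log_pos_aux (n : ℕ) (hn : 2 ≤ n) : 0 < Real.log n :=
  Real.log_pos (by exact_mod_cast hn)

lemma d_lower (n : ℕ) (hn : 1 ≤ n) :
    1 / ((n : ℝ) + 1) ≤ Real.log ((n : ℝ) + 1) - Real.log n := by
  have hn' : (0 : ℝ) < n := by exact_mod_cast hn
  rw [← Real.log_div (by positivity) (by positivity)]
  have := Real.one_sub_inv_le_log_of_pos (show (0 : ℝ) < (n + 1) / n by positivity)
  refine le_trans (le_of_eq ?_) this
  field_simp
  ring

lemma d_upper (n : ℕ) (hn : 1 ≤ n) :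
    Real.log ((n : ℝ) + 1) - Real.log n ≤ 1 / (n : ℝ) := by
  have hn' : (0 : ℝ) < n := by exact_mod_cast hn
  rw [← Real.log_div (by positivity) (by positivity)]
  have := Real.log_le_sub_one_of_pos (show (0 : ℝ) < (n + 1) / n by positivity)
  refine le_trans this (le_of_eq ?_)
  field_simp
  ring

lemma d_pos (n : ℕ) (hn : 1 ≤ n) : 0 < Real.log ((n : ℝ) + 1) - Real.log n :=
  lt_of_lt_of_le (by positivity) (d_lower n hn)

lemma q_mul (n : ℕ) (hn : 2 ≤ n) :
    q n * (Real.log ((n : ℝ) + 1) - Real.log n)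
      = Real.log (Real.log ((n : ℝ) + 1)) - Real.log (Real.log n) := by
  have h0 := log_pos_aux n hn
  have hd := d_pos n (by omega)
  have hn' : (0 : ℝ) < n := by positivity
  unfold q
  rw [Real.log_div (by positivity) (by linarith), Real.log_div (by positivity) (by positivity)]
  have : Real.log n - Real.log ((n : ℝ) + 1) ≠ 0 := by linarith
  field_simp
  ring

lemma q_le (n : ℕ) (hn : 2 ≤ n) : q n ≤ 1 / Real.log n := by
  have h0 := log_pos_aux n hn
  have hd := d_pos n (by omega)
  have h := q_mul n hn
  rw [← Real.log_div (x := Real.log ((n : ℝ) + 1)) (y := Real.log n) (by linarith) (by linarith)] at h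
  have h2 := Real.log_le_sub_one_of_pos
    (show 0 < Real.log ((n : ℝ) + 1) / Real.log n from div_pos (by linarith) h0)
  refine le_of_mul_le_mul_right ?_ hd
  rw [h]
  refine h2.trans (le_of_eq ?_)
  field_simp

lemma le_q (n : ℕ) (hn : 2 ≤ n) : 1 / Real.log ((n : ℝ) + 1) ≤ q n := by
  have h0 := log_pos_aux n hn
  have hd := d_pos n (by omega)
  have h := q_mul n hn
  rw [← Real.log_div (x := Real.log ((n : ℝ) + 1)) (y := Real.log n) (by linarith) (by linarith)] at h
  have h1 : 0 < Real.log ((n : ℝ) + 1) := by linarith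
  have h2 := Real.one_sub_inv_le_log_of_pos
    (show 0 < Real.log ((n : ℝ) + 1) / Real.log n from div_pos (by linarith) h0)
  refine le_of_mul_le_mul_right ?_ hd
  rw [h]
  refine le_trans (le_of_eq ?_) h2
  field_simp

lemma q_succ_le (n : ℕ) (hn : 2 ≤ n) : q (n + 1) ≤ q n := by
  have := q_le (n + 1) (by omega)
  push_cast at this
  exact this.trans (le_q n hn)

lemma q_anti (m n : ℕ) (hm : 2 ≤ m) (h : m ≤ n) : q n ≤ q m := by
  induction n, h using Nat.le_induction with
  | base => exact le_rfl
  | succ n hn ih => exact (q_succ_le n (by omega)).trans ih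

lemma q_integral (n : ℕ) (hn : 2 ≤ n) :
    IntervalIntegrable (fun u : ℝ => 1 / (Real.log n + u * (Real.log ((n : ℝ) + 1) - Real.log n)))
      MeasureTheory.volume 0 1 ∧
    ∫ u in (0 : ℝ)..1, 1 / (Real.log n + u * (Real.log ((n : ℝ) + 1) - Real.log n)) = q n := by
  have h0 := log_pos_aux n hn
  have hd := d_pos n (by omega)
  set d := Real.log ((n : ℝ) + 1) - Real.log n with hd_def
  have hpos : ∀ u ∈ Set.uIcc (0 : ℝ) 1, 0 < Real.log n + u * d := by
    intro u hu
    rw [Set.uIcc_of_le zero_le_one] at hu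
    have := mul_nonneg hu.1 hd.le
    linarith
  have hint : IntervalIntegrable (fun u : ℝ => 1 / (Real.log n + u * d))
      MeasureTheory.volume 0 1 := by
    apply ContinuousOn.intervalIntegrable
    apply ContinuousOn.div continuousOn_const (by fun_prop)
    intro u hu
    exact (hpos u hu).ne'
  refine ⟨hint, ?_⟩
  have key := intervalIntegral.integral_eq_sub_of_hasDerivAt
    (f := fun u : ℝ => Real.log (Real.log n + u * d) / d)
    (f' := fun u : ℝ => 1 / (Real.log n + u * d)) (a := 0) (b := 1) ?_ hint
  · rw [key]
    have h := q_mul n hn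
    rw [← hd_def] at h
    have e1 : Real.log n + 1 * d = Real.log ((n : ℝ) + 1) := by rw [hd_def]; ring
    simp only [e1, zero_mul, add_zero]
    field_simp
    linarith
  · intro u hu
    have hp := hpos u hu
    have h1 : HasDerivAt (fun u : ℝ => Real.log n + u * d) d u := by
      simpa using ((hasDerivAt_id u).mul_const d).const_add (Real.log n)
    have h2 := (h1.log hp.ne').div_const d
    rwa [div_right_comm, div_self hd.ne'] at h2

lemma q_three (m : ℕ) (hm : 10 ≤ m) : q m - q (m + 1) ≤ 2 * (q (m + 1) - q (m + 2)) := by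
  obtain ⟨i0, e0⟩ := q_integral m (by omega)
  obtain ⟨i1, e1⟩ := q_integral (m + 1) (by omega)
  obtain ⟨i2, e2⟩ := q_integral (m + 2) (by omega)
  have hm' : (10 : ℝ) ≤ m := by exact_mod_cast hm
  have t0 : 1 ≤ Real.log m := by
    rw [Real.le_log_iff_exp_le (by linarith)]
    linarith [Real.exp_one_lt_d9]
  have u0 := d_upper m (by omega)
  have u1 := d_upper (m + 1) (by omega)
  have u2 := d_upper (m + 2) (by omega)
  have l0 := d_lower m (by omega)
  have l1 := d_lower (m + 1) (by omega)
  have l2 := d_lower (m + 2) (by omega)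
  push_cast at *
  rw [show (m : ℝ) + 1 + 1 = m + 2 by ring] at *
  rw [show (m : ℝ) + 2 + 1 = m + 3 by ring] at *
  have b0 : (0 : ℝ) < 1 / (m + 1) := by positivity
  have b1 : (0 : ℝ) < 1 / (m + 2) := by positivity
  have b2 : (0 : ℝ) < 1 / (m + 3) := by positivity
  have c1 : 1 / ((m : ℝ) + 1) ≤ 1 / m := one_div_le_one_div_of_le (by linarith) (by linarith)
  have c2 : 1 / ((m : ℝ) + 2) ≤ 1 / m := one_div_le_one_div_of_le (by linarith) (by linarith)
  -- monotonicity of the gaps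
  have g01 : Real.log ((m : ℝ) + 2) - Real.log (m + 1) ≤ Real.log ((m : ℝ) + 1) - Real.log m := by
    linarith
  have g12 : Real.log ((m : ℝ) + 3) - Real.log (m + 2)
      ≤ Real.log ((m : ℝ) + 2) - Real.log (m + 1) := by
    linarith
  have hkey : (Real.log ((m : ℝ) + 1) - Real.log m) * Real.log ((m : ℝ) + 3)
      ≤ 2 * (Real.log ((m : ℝ) + 3) - Real.log (m + 2)) * Real.log m := by
    have hA : (Real.log ((m : ℝ) + 1) - Real.log m) * Real.log ((m : ℝ) + 3)
        ≤ (1 / m) * (Real.log m + 3 * (1 / m)) := by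
      apply mul_le_mul u0 (by linarith) (by linarith) (by positivity)
    have hB : 2 * (1 / ((m : ℝ) + 3)) * Real.log m
        ≤ 2 * (Real.log ((m : ℝ) + 3) - Real.log (m + 2)) * Real.log m := by
      apply mul_le_mul_of_nonneg_right _ (by linarith)
      linarith
    refine hA.trans (le_trans ?_ hB)
    set t := Real.log m
    have hmp : (0 : ℝ) < m := by linarith
    rw [← sub_nonneg]
    have : 2 * (1 / ((m : ℝ) + 3)) * t - (1 / m) * (t + 3 * (1 / m))
        = (m * (m - 3) * t - 3 * m - 9) / (m ^ 2 * (m + 3)) := by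
      field_simp
      ring
    rw [this]
    apply div_nonneg _ (by positivity)
    nlinarith [mul_nonneg (mul_nonneg hmp.le (show (0 : ℝ) ≤ m - 3 by linarith)) (sub_nonneg.2 t0)]
  have hmono : ∫ u in (0 : ℝ)..1,
      (1 / (Real.log m + u * (Real.log ((m : ℝ) + 1) - Real.log m)) +
        2 * (1 / (Real.log ((m : ℝ) + 2) + u * (Real.log ((m : ℝ) + 3) - Real.log (m + 2))))) ≤
      ∫ u in (0 : ℝ)..1,
        3 * (1 / (Real.log ((m : ℝ) + 1) + u * (Real.log ((m : ℝ) + 2) - Real.log (m + 1)))) := by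
    apply intervalIntegral.integral_mono_on zero_le_one (i0.add (i2.const_mul 2)) (i1.const_mul 3)
    intro u hu
    obtain ⟨hu0, hu1⟩ := hu
    set a := Real.log (m : ℝ)
    set b := Real.log ((m : ℝ) + 1)
    set c := Real.log ((m : ℝ) + 2)
    set e := Real.log ((m : ℝ) + 3)
    set x := a + u * (b - a) with hx
    set y := b + u * (c - b) with hy
    set z := c + u * (e - c) with hz
    have hxa : a ≤ x := by nlinarith
    have hze : z ≤ e := by nlinarith
    have hyx : y - x ≤ b - a := by nlinarith
    have hzy : e - c ≤ z - y := by nlinarith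
    have hyx0 : 0 ≤ y - x := by nlinarith
    have x0 : 0 < x := by linarith
    have y0 : 0 < y := by linarith
    have z0 : 0 < z := by linarith
    have hmain : (y - x) * z ≤ 2 * (z - y) * x := by
      calc (y - x) * z ≤ (b - a) * e := mul_le_mul hyx hze z0.le (by linarith)
        _ ≤ 2 * (e - c) * a := hkey
        _ ≤ 2 * (z - y) * x := mul_le_mul (by linarith) hxa (by linarith) (by linarith)
    rw [← sub_nonneg]
    have : 3 * (1 / y) - (1 / x + 2 * (1 / z))
        = (2 * (z - y) * x - (y - x) * z) / (x * y * z) := by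
      field_simp
      ring
    rw [this]
    apply div_nonneg (by linarith) (by positivity)
  rw [intervalIntegral.integral_add i0 (i2.const_mul 2), intervalIntegral.integral_const_mul,
    intervalIntegral.integral_const_mul, e0, e1, e2] at hmono
  linarith

lemma log_three_lower : 1.09 ≤ Real.log 3 := by
  have h1 : Real.log (9 / 8) = 2 * Real.log 3 - 3 * Real.log 2 := by
    rw [Real.log_div (by norm_num) (by norm_num), show (9 : ℝ) = 3 ^ 2 by norm_num,
      show (8 : ℝ) = 2 ^ 3 by norm_num, Real.log_pow, Real.log_pow]
    norm_num
  have h2 := Real.one_sub_inv_le_log_of_pos (show (0 : ℝ) < 9 / 8 by norm_num)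
  have h3 := Real.log_two_gt_d9
  norm_num at *
  linarith

/-- The absolute value of the `n`-th term. -/
noncomputable def A (k : ℕ) (σ : ℝ) (n : ℕ) : ℝ := Real.log n ^ k * (n : ℝ) ^ (-σ)

lemma A_pos (k : ℕ) (σ : ℝ) (n : ℕ) (hn : 2 ≤ n) : 0 < A k σ n := by
  have := log_pos_aux n hn
  unfold A
  positivity

lemma A_exp (k : ℕ) (σ : ℝ) (n : ℕ) (hn : 2 ≤ n) :
    A k σ n = Real.exp (k * Real.log (Real.log n) - σ * Real.log n) := by
  have := log_pos_aux n hn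
  unfold A
  rw [sub_eq_add_neg, Real.exp_add, ← Real.log_pow, Real.exp_log (by positivity),
    Real.rpow_def_of_pos (by positivity)]
  congr 2
  ring

lemma A_ratio (k : ℕ) (σ : ℝ) (n : ℕ) (hn : 2 ≤ n) :
    A k σ n = A k σ (n + 1) * Real.exp ((σ - q n * k) * (Real.log ((n : ℝ) + 1) - Real.log n)) := by
  rw [A_exp k σ n hn, A_exp k σ (n + 1) (by omega), ← Real.exp_add]
  congr 1
  push_cast
  linear_combination (k : ℝ) * q_mul n hn

lemma A_up (k : ℕ) (σ : ℝ) (n : ℕ) (hn : 2 ≤ n) (E : ℝ) (hE : 1 ≤ E) (h : E ≤ σ - q n * k) :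
    (n + E) * A k σ (n + 1) ≤ n * A k σ n := by
  have hn' : (0 : ℝ) < n := by positivity
  have hA := A_pos k σ (n + 1) (by omega)
  have h1 : 1 + E * (1 / n) ≤ Real.exp ((σ - q n * k) * (Real.log ((n : ℝ) + 1) - Real.log n)) := by
    have hb := one_add_mul_self_le_rpow_one_add (s := 1 / (n : ℝ))
      (by have : (0 : ℝ) < 1 / n := by positivity
          linarith) hE
    refine hb.trans ?_
    rw [Real.rpow_def_of_pos (by positivity), ← Real.log_div (by positivity) (by positivity)]
    apply Real.exp_le_exp.2
    rw [show (1 : ℝ) + 1 / n = (n + 1) / n by field_simp, mul_comm]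
    apply mul_le_mul_of_nonneg_right h
    rw [Real.log_div (by positivity) (by positivity)]
    exact (d_pos n (by omega)).le
  rw [A_ratio k σ n hn]
  have h2 : (n : ℝ) + E = n * (1 + E * (1 / n)) := by field_simp
  rw [h2]
  have h3 := mul_le_mul_of_nonneg_left h1 (mul_pos hn' hA).le
  linarith

lemma exp_bound (N n : ℕ) (hn : 1 ≤ n) (hN : n + 1 ≤ N) (e : ℝ) (he : (N : ℝ) * Real.log 3 ≤ e) :
    3 ≤ Real.exp (e * (Real.log ((n : ℝ) + 1) - Real.log n)) := by
  have h3 := log_three_lower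
  have hl := d_lower n hn
  rw [← Real.log_le_iff_le_exp (by norm_num)]
  have hN' : (n : ℝ) + 1 ≤ N := by exact_mod_cast hN
  have hn' : (0 : ℝ) < (n : ℝ) + 1 := by positivity
  calc Real.log 3 = ((n + 1) * Real.log 3) * (1 / ((n : ℝ) + 1)) := by field_simp
    _ ≤ e * (Real.log ((n : ℝ) + 1) - Real.log n) := by
      apply mul_le_mul _ hl (by positivity)
      · exact le_trans (by positivity) he
      · exact le_trans (mul_le_mul_of_nonneg_right hN' (by linarith)) he

lemma lower_sum (M k : ℕ) (hk : 1 ≤ k) (σ : ℝ) (h2 : σ ≤ q (M - 1) * k - (M : ℝ) * Real.log 3)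
    (n : ℕ) (hn : 2 ≤ n) (hnM : n ≤ M) :
    ∑ i ∈ Finset.range n, A k σ i < A k σ n / 2 := by
  induction n, hn using Nat.le_induction with
  | base =>
    have := A_pos k σ 2 le_rfl
    have e0 : A k σ 0 = 0 := by simp [A, show k ≠ 0 by omega]
    have e1 : A k σ 1 = 0 := by simp [A, show k ≠ 0 by omega]
    rw [Finset.sum_range_succ, Finset.sum_range_succ, e0, e1]
    simp only [Finset.range_zero, Finset.sum_empty]
    linarith
  | succ n hn ih =>
    have ih := ih (by omega)
    rw [Finset.sum_range_succ]
    have hq := q_anti n (M - 1) hn (by omega)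
    have hqk : q (M - 1) * k ≤ q n * k := mul_le_mul_of_nonneg_right hq (by positivity)
    have hb := exp_bound M n (by omega) hnM (-(σ - q n * k)) (by linarith)
    have hr := A_ratio k σ n hn
    have hA := A_pos k σ n hn
    rw [neg_mul, Real.exp_neg] at hb
    have : A k σ (n + 1) = A k σ n *
        (Real.exp ((σ - q n * k) * (Real.log ((n : ℝ) + 1) - Real.log n)))⁻¹ := by
      rw [hr]
      field_simp
    have := mul_le_mul_of_nonneg_left hb hA.le
    linarith

lemma upper_sum (k : ℕ) (σ : ℝ) (N : ℕ) (hN : 2 ≤ N) (E : ℝ) (hE : 1 ≤ E)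
    (h : E ≤ σ - q N * k) (m : ℕ) :
    (E - 1) * ∑ i ∈ Finset.range (N + 1 + m), A k σ i ≤
      (E - 1) * ∑ i ∈ Finset.range (N + 1), A k σ i +
      (N * A k σ N - ((N + m : ℕ) : ℝ) * A k σ (N + m)) := by
  induction m with
  | zero => simp
  | succ m ih =>
    have hq : q (N + m) * k ≤ q N * k :=
      mul_le_mul_of_nonneg_right (q_anti N (N + m) hN (by omega)) (by positivity)
    have hu := A_up k σ (N + m) (by omega) E hE (by linarith)
    rw [show N + 1 + (m + 1) = (N + 1 + m) + 1 by ring, Finset.sum_range_succ,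
      show N + 1 + m = N + m + 1 by ring, ← add_assoc N m 1]
    rw [show N + 1 + m = N + m + 1 by ring] at ih
    push_cast at *
    linarith

lemma total_sum (M : ℕ) (hM : 11 ≤ M) (k : ℕ) (hk : 1 ≤ k) (σ : ℝ)
    (h1 : q M * k + ((M : ℝ) + 1) * Real.log 3 ≤ σ)
    (h2 : σ ≤ q (M - 1) * k - (M : ℝ) * Real.log 3) :
    ∃ C < 2 * A k σ M, ∀ n, ∑ i ∈ Finset.range n, A k σ i ≤ C := by
  have hM' : (11 : ℝ) ≤ M := by exact_mod_cast hM
  have h3 := log_three_lower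
  have hq := q_three (M - 1) (by omega)
  rw [show M - 1 + 1 = M by omega, show M - 1 + 2 = M + 1 by omega] at hq
  have hqk := mul_le_mul_of_nonneg_right hq (show (0 : ℝ) ≤ k by positivity)
  have hE : 2 * (M : ℝ) + 3 ≤ σ - q (M + 1) * k := by nlinarith
  have hl := lower_sum M k hk σ h2 M (by omega) le_rfl
  have hr := A_ratio k σ M (by omega)
  have hb := exp_bound (M + 1) M (by omega) le_rfl (σ - q M * k) (by push_cast; linarith)
  have hA1 := A_pos k σ (M + 1) (by omega)
  have hA : 3 * A k σ (M + 1) ≤ A k σ M := by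
    have := mul_le_mul_of_nonneg_left hb hA1.le
    linarith
  have hu := upper_sum k σ (M + 1) (by omega) (2 * (M : ℝ) + 3) (by linarith) hE
  have hA0 : ∀ n, 0 ≤ A k σ n := by
    intro n
    unfold A
    have := Real.log_natCast_nonneg n
    positivity
  refine ⟨∑ i ∈ Finset.range M, A k σ i + A k σ M + A k σ (M + 1) + A k σ (M + 1) / 2,
    by linarith, ?_⟩
  intro n
  have hmono : ∑ i ∈ Finset.range n, A k σ i ≤ ∑ i ∈ Finset.range (M + 1 + 1 + n), A k σ i :=
    Finset.sum_le_sum_of_subset_of_nonneg (Finset.range_mono (by omega)) (fun i _ _ => hA0 i)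
  refine hmono.trans ?_
  have hun := hu n
  rw [Finset.sum_range_succ _ (M + 1), Finset.sum_range_succ _ M] at hun
  have hp : 0 ≤ ((M + 1 + n : ℕ) : ℝ) * A k σ (M + 1 + n) := mul_nonneg (by positivity) (hA0 _)
  have hc : (0 : ℝ) < 2 * (M : ℝ) + 3 - 1 := by linarith
  refine le_of_mul_le_mul_left ?_ hc
  push_cast at *
  linarith

open LSeries in
/-- For every integer `M ≥ 11`, every positive integer `k`, and every complex `s` with
`q M * k + (M+1) log 3 ≤ Re s ≤ q (M-1) * k - M log 3`, the `k`-th derivative of the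
Riemann zeta function does not vanish at `s`. -/
theorem zeta_deriv_ne_zero_M_ge_eleven (M : ℕ) (hM : 11 ≤ M) (k : ℕ) (hk : 1 ≤ k) (s : ℂ)
    (h1 : q M * k + ((M : ℝ) + 1) * Real.log 3 ≤ s.re)
    (h2 : s.re ≤ q (M - 1) * k - (M : ℝ) * Real.log 3) :
    iteratedDeriv k riemannZeta s ≠ 0 := by
  obtain ⟨C, hC, hsum⟩ := total_sum M hM k hk s.re h1 h2
  have hM' : (11 : ℝ) ≤ M := by exact_mod_cast hM
  have hre : 1 < s.re := by
    have hq : 0 ≤ q M := by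
      refine le_trans ?_ (le_q M (by omega))
      have := Real.log_nonneg (show (1 : ℝ) ≤ (M : ℝ) + 1 by linarith)
      positivity
    have : 0 ≤ q M * k := mul_nonneg hq (by positivity)
    nlinarith [log_three_lower]
  have habs : abscissaOfAbsConv (1 : ℕ → ℂ) < s.re := by
    rw [abscissaOfAbsConv_one]
    exact_mod_cast hre
  have hev : riemannZeta =ᶠ[nhds s] LSeries 1 := by
    have ho : IsOpen {z : ℂ | 1 < z.re} := isOpen_lt continuous_const Complex.continuous_re
    filter_upwards [ho.mem_nhds hre] with z hz
    exact (LSeries_one_eq_riemannZeta hz).symm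
  rw [hev.iteratedDeriv_eq k, LSeries_iteratedDeriv k habs]
  refine mul_ne_zero (pow_ne_zero _ (by norm_num)) ?_
  have hlog : ∀ (j n : ℕ), (logMul^[j] (1 : ℕ → ℂ)) n = Complex.log n ^ j := by
    intro j n
    induction j with
    | zero => simp
    | succ j ih => rw [Function.iterate_succ_apply', logMul, ih, pow_succ']
  have hnorm : ∀ n, ‖term (logMul^[k] (1 : ℕ → ℂ)) s n‖ = A k s.re n := by
    intro n
    rw [norm_term_eq, hlog, A]
    rcases eq_or_ne n 0 with rfl | hn
    · simp [show k ≠ 0 by omega]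
    · rw [if_neg hn, norm_pow, ← Complex.natCast_log, Complex.norm_real, Real.norm_of_nonneg
        (Real.log_natCast_nonneg n), Real.rpow_neg (by positivity), div_eq_mul_inv]
  set f := term (logMul^[k] (1 : ℕ → ℂ)) s with hf
  have hA0 : ∀ n, 0 ≤ A k s.re n := fun n => hnorm n ▸ norm_nonneg _
  have hsA : Summable (A k s.re) := summable_of_sum_range_le hA0 hsum
  have htA : ∑' n, A k s.re n ≤ C := Real.tsum_le_of_sum_range_le hA0 hsum
  have hfn : Summable (fun n => ‖f n‖) := by simpa only [hnorm] using hsA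
  intro h0
  rw [LSeries, ← hf, hfn.of_norm.tsum_eq_add_tsum_ite M] at h0
  have h3 : ‖f M‖ = ‖∑' n, ite (n = M) 0 (f n)‖ := by
    rw [eq_neg_of_add_eq_zero_left h0, norm_neg]
  have heq : (fun n => ‖ite (n = M) 0 (f n)‖) = fun n => ite (n = M) 0 (A k s.re n) := by
    funext n
    split_ifs
    · simp
    · exact hnorm n
  have hs' : Summable (fun n => ‖ite (n = M) 0 (f n)‖) := by
    refine hfn.of_nonneg_of_le (fun _ => norm_nonneg _) (fun n => ?_)
    split_ifs <;> simp
  have h4 := norm_tsum_le_tsum_norm hs'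
  rw [heq] at h4
  have h5 := hsA.tsum_eq_add_tsum_ite M
  rw [hnorm] at h3
  linarith
end

section
/- Let M ≥ 2 and k ≥ 3 be integers such that the critical strip S_M^k exists, i.e. q_{M+1}·k + (M+2)·log 3 < q_M·k − (M+1)·log 3. Then for every integer j and every real σ with q_M·k − (M+1)·log 3 ≤ σ ≤ q_M·k + (M+1)·log 3, one has iteratedDeriv k riemannZeta (σ + i·2πj/(log(M+1) − log M)) ≠ 0; that is, ζ^(k) has no zeros on the horizontal line segments of S_M^k at heights t = 2πj/(log(M+1) − log M). -/
open Finset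

lemma aux_logn_pos {n : ℕ} (hn : 2 ≤ n) : 0 < Real.log (n : ℝ) :=
  Real.log_pos (by exact_mod_cast hn)

lemma aux_log_lt {m n : ℕ} (hm : 2 ≤ m) (h : m < n) : Real.log (m : ℝ) < Real.log (n : ℝ) :=
  Real.log_lt_log (by positivity) (by exact_mod_cast h)

/-- `q` as a slope. -/
lemma aux_q_eq {n : ℕ} (hn : 2 ≤ n) :
    q n = (Real.log (Real.log ((n + 1 : ℕ) : ℝ)) - Real.log (Real.log (n : ℝ))) /
      (Real.log ((n + 1 : ℕ) : ℝ) - Real.log (n : ℝ)) := by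
  have h1 := aux_logn_pos hn
  have h2 := aux_logn_pos (show 2 ≤ n + 1 by omega)
  unfold q
  have h3 : (n : ℝ) ≠ 0 := by positivity
  have h4 : ((n + 1 : ℕ) : ℝ) ≠ 0 := by positivity
  have e : (n : ℝ) + 1 = ((n + 1 : ℕ) : ℝ) := by push_cast; ring
  rw [e, Real.log_div h1.ne' h2.ne', Real.log_div h3 h4, ← neg_div_neg_eq]
  simp only [neg_sub]

lemma aux_q_pos {n : ℕ} (hn : 2 ≤ n) : 0 < q n := by
  rw [aux_q_eq hn]
  have h1 := aux_logn_pos hn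
  have h2 := aux_log_lt hn (Nat.lt_succ_self n)
  have h3 := Real.log_lt_log h1 h2
  exact div_pos (by linarith) (by linarith)

lemma aux_integral {a b : ℝ} (ha : 0 < a) (hab : a < b) :
    ∫ t in (0 : ℝ)..1, (a + (b - a) * t)⁻¹ = (Real.log b - Real.log a) / (b - a) := by
  have hc : b - a ≠ 0 := by linarith
  rw [intervalIntegral.integral_comp_add_mul (fun x => x⁻¹) hc]
  have : a + (b - a) * 1 = b := by ring
  rw [this, mul_zero, add_zero, integral_inv_of_pos ha (by linarith),
    Real.log_div (by linarith) ha.ne', smul_eq_mul]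
  field_simp

lemma aux_integrable {a b : ℝ} (ha : 0 < a) (hab : a < b) :
    IntervalIntegrable (fun t : ℝ => (a + (b - a) * t)⁻¹) MeasureTheory.volume 0 1 := by
  apply ContinuousOn.intervalIntegrable
  apply ContinuousOn.inv₀ (by fun_prop)
  intro t ht
  rw [Set.uIcc_of_le zero_le_one] at ht
  have : 0 ≤ (b - a) * t := mul_nonneg (by linarith) ht.1
  linarith

lemma aux_log_mid {n : ℕ} (hn : 2 ≤ n) :
    Real.log (n : ℝ) + Real.log ((n + 2 : ℕ) : ℝ) ≤ 2 * Real.log ((n + 1 : ℕ) : ℝ) := by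
  have h3 : (n : ℝ) ≠ 0 := by positivity
  have h4 : ((n + 2 : ℕ) : ℝ) ≠ 0 := by positivity
  rw [← Real.log_mul h3 h4]
  have : 2 * Real.log ((n + 1 : ℕ) : ℝ) = Real.log (((n + 1 : ℕ) : ℝ) ^ 2) := by
    rw [Real.log_pow]; norm_num
  rw [this]
  apply Real.log_le_log (by positivity)
  push_cast
  nlinarith

/-- Discrete convexity of `q`. -/
lemma aux_q_convex {n : ℕ} (hn : 2 ≤ n) : 2 * q (n + 1) ≤ q n + q (n + 2) := by
  have p0 := aux_logn_pos hn
  have p1 := aux_logn_pos (show 2 ≤ n + 1 by omega)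
  have p2 := aux_logn_pos (show 2 ≤ n + 2 by omega)
  have l0 := aux_log_lt hn (show n < n + 1 by omega)
  have l1 := aux_log_lt (show 2 ≤ n + 1 by omega) (show n + 1 < n + 2 by omega)
  have l2 := aux_log_lt (show 2 ≤ n + 2 by omega) (show n + 2 < n + 3 by omega)
  have m0 := aux_log_mid hn
  have m1 := aux_log_mid (show 2 ≤ n + 1 by omega)
  rw [aux_q_eq hn, aux_q_eq (show 2 ≤ n + 1 by omega), aux_q_eq (show 2 ≤ n + 2 by omega)]
  simp only [show n + 1 + 1 = n + 2 by omega, show n + 2 + 1 = n + 3 by omega,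
    show n + 1 + 2 = n + 3 by omega] at *
  rw [← aux_integral p0 l0, ← aux_integral p1 l1, ← aux_integral p2 l2,
    ← intervalIntegral.integral_const_mul,
    ← intervalIntegral.integral_add (aux_integrable p0 l0) (aux_integrable p2 l2)]
  apply intervalIntegral.integral_mono_on zero_le_one
  · exact (aux_integrable p1 l1).const_mul 2
  · exact (aux_integrable p0 l0).add (aux_integrable p2 l2)
  intro t ht
  generalize Real.log (n : ℝ) = a at *
  generalize Real.log ((n + 1 : ℕ) : ℝ) = b at *
  generalize Real.log ((n + 2 : ℕ) : ℝ) = c at *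
  generalize Real.log ((n + 3 : ℕ) : ℝ) = d at *
  obtain ⟨t0, t1⟩ := ht
  have hx : 0 < a + (b - a) * t := by
    have : 0 ≤ (b - a) * t := mul_nonneg (by linarith) t0
    linarith
  have hz : 0 < c + (d - c) * t := by
    have : 0 ≤ (d - c) * t := mul_nonneg (by linarith) t0
    linarith
  have hy : (a + (b - a) * t) + (c + (d - c) * t) ≤ 2 * (b + (c - b) * t) := by
    nlinarith [mul_le_mul_of_nonneg_left m0 (show 0 ≤ 1 - t by linarith),
      mul_le_mul_of_nonneg_left m1 t0]
  generalize a + (b - a) * t = x at *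
  generalize c + (d - c) * t = z at *
  generalize b + (c - b) * t = y at *
  have hy0 : 0 < y := by linarith
  have : 2 * y⁻¹ ≤ 4 / (x + z) := by
    rw [← div_eq_mul_inv, div_le_div_iff₀ hy0 (by linarith)]
    linarith
  refine this.trans ?_
  rw [← one_div, ← one_div, div_add_div _ _ hx.ne' hz.ne', div_le_div_iff₀ (by linarith) (by positivity)]
  nlinarith [sq_nonneg (x - z)]

/-- Concavity above. -/
lemma aux_secant_up {N n : ℕ} (hN : 2 ≤ N) (hn : N + 1 ≤ n) :
    Real.log (Real.log (n : ℝ)) - Real.log (Real.log (N : ℝ)) ≤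
      q N * (Real.log (n : ℝ) - Real.log (N : ℝ)) := by
  have p0 := aux_logn_pos hN
  have p1 := aux_logn_pos (show 2 ≤ N + 1 by omega)
  have l0 := aux_log_lt hN (show N < N + 1 by omega)
  have l1 := aux_log_lt hN (show N < n by omega)
  rw [aux_q_eq hN, ← div_le_iff₀ (by linarith)]
  rcases hn.eq_or_lt with rfl | h
  · exact le_rfl
  have l2 := aux_log_lt (show 2 ≤ N + 1 by omega) h
  exact (strictConcaveOn_log_Ioi.secant_strict_mono (Set.mem_Ioi.2 p0) (Set.mem_Ioi.2 p1)
    (Set.mem_Ioi.2 (p1.trans l2)) l0.ne' l1.ne' l2).le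

/-- Concavity below. -/
lemma aux_secant_down {P n : ℕ} (hn : 2 ≤ n) (hP : n ≤ P) :
    q P * (Real.log ((P + 1 : ℕ) : ℝ) - Real.log (n : ℝ)) ≤
    Real.log (Real.log ((P + 1 : ℕ) : ℝ)) - Real.log (Real.log (n : ℝ)) := by
  have hP2 : 2 ≤ P := by omega
  have p0 := aux_logn_pos hn
  have p1 := aux_logn_pos hP2
  have l0 := aux_log_lt hP2 (show P < P + 1 by omega)
  have l1 := aux_log_lt hn (show n < P + 1 by omega)
  rw [aux_q_eq hP2, ← le_div_iff₀ (by linarith)]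
  rcases hP.eq_or_lt with rfl | h
  · exact le_rfl
  have l2 := aux_log_lt hn h
  have := (strictConcaveOn_log_Ioi.secant_strict_mono (Set.mem_Ioi.2 (p1.trans l0))
    (Set.mem_Ioi.2 p0)
    (Set.mem_Ioi.2 p1) l1.ne l0.ne l2).le
  rw [← neg_div_neg_eq, ← neg_div_neg_eq (Real.log (Real.log (n : ℝ)) - _)] at this
  simpa only [neg_sub] using this

lemma aux_tail_sum {N : ℕ} (hN : 1 ≤ N) (K : ℕ) :
    ∑ i ∈ range K, ((N : ℝ) / ((N + 1 + i : ℕ) : ℝ)) ^ (N + 1) ≤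
      1 - ((N : ℝ) / ((N + K : ℕ) : ℝ)) ^ N := by
  have hN0 : (0 : ℝ) < N := by exact_mod_cast hN
  induction K with
  | zero => simp [div_self hN0.ne']
  | succ K ih =>
    rw [sum_range_succ]
    have e : N + 1 + K = N + (K + 1) := by omega
    rw [e]
    set m : ℝ := ((N + K : ℕ) : ℝ) with hm
    have hm0 : 0 < m := by rw [hm]; push_cast; positivity
    have e2 : ((N + (K + 1) : ℕ) : ℝ) = m + 1 := by rw [hm]; push_cast; ring
    rw [e2]
    have hb : 1 + (N : ℝ) * (1 / m) ≤ (1 + 1 / m) ^ N :=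
      one_add_mul_le_pow (by have : 0 ≤ 1 / m := by positivity
                             linarith) N
    have e3 : ((N : ℝ) / m) ^ N = (N / (m + 1)) ^ N * (1 + 1 / m) ^ N := by
      rw [← mul_pow]; congr 1; field_simp
    have h4 : (N : ℝ) / (m + 1) ≤ N * (1 / m) := by
      rw [mul_one_div]
      exact div_le_div_of_nonneg_left hN0.le hm0 (by linarith)
    have h5 : 0 ≤ ((N : ℝ) / (m + 1)) ^ N := by positivity
    have h6 := mul_le_mul_of_nonneg_left (show 1 + (N : ℝ) / (m + 1) ≤ (1 + 1 / m) ^ N by linarith) h5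
    rw [pow_succ]
    rw [e3] at ih
    linarith

lemma aux_bern (P n : ℕ) : (P + 1) * n ^ P + n ^ (P + 1) ≤ (n + 1) ^ (P + 1) := by
  induction P with
  | zero => simp; omega
  | succ P ih =>
    have := Nat.mul_le_mul_right (n + 1) ih
    rw [pow_succ (n + 1)]
    refine le_trans ?_ this
    have : 0 ≤ (P + 1) * n ^ P := Nat.zero_le _
    ring_nf at *
    omega

lemma aux_head_sum {P : ℕ} (hP : 1 ≤ P) (K : ℕ) :
    ∑ n ∈ range (K + 1), (P + 1) * n ^ P + 1 ≤ (K + 1) ^ (P + 1) := by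
  induction K with
  | zero => simp; omega
  | succ K ih =>
    rw [sum_range_succ]
    have := aux_bern P (K + 1)
    omega

lemma aux_head_sum' {P : ℕ} (hP : 1 ≤ P) :
    ∑ n ∈ range (P + 1), ((n : ℝ) / ((P + 1 : ℕ) : ℝ)) ^ P < 1 := by
  have h := aux_head_sum hP P
  have h' : ∑ n ∈ range (P + 1), ((P + 1 : ℕ) : ℝ) * (n : ℝ) ^ P + 1 ≤ ((P + 1 : ℕ) : ℝ) ^ (P + 1) := by
    exact_mod_cast h
  have hp : (0 : ℝ) < ((P + 1 : ℕ) : ℝ) := by positivity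
  rw [← mul_sum, pow_succ] at h'
  simp_rw [div_pow]
  rw [← sum_div, div_lt_one (by positivity)]
  by_contra hcon
  push Not at hcon
  have := mul_le_mul_of_nonneg_left hcon hp.le
  nlinarith

/-- The size of the `n`-th term. -/
noncomputable def auxL (k : ℕ) (σ : ℝ) (n : ℕ) : ℝ := Real.log (n : ℝ) ^ k / (n : ℝ) ^ σ

lemma auxL_nonneg (k : ℕ) (σ : ℝ) (n : ℕ) : 0 ≤ auxL k σ n :=
  div_nonneg (pow_nonneg (Real.log_natCast_nonneg n) _) (by positivity)

lemma auxL_eq {k : ℕ} {σ : ℝ} {n : ℕ} (hn : 2 ≤ n) :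
    auxL k σ n = Real.exp (k * Real.log (Real.log (n : ℝ)) - σ * Real.log n) := by
  have h1 := aux_logn_pos hn
  have hn0 : (0 : ℝ) < n := by positivity
  rw [auxL, Real.exp_sub, Real.rpow_def_of_pos hn0, mul_comm (Real.log (n : ℝ)) σ,
    mul_comm (k : ℝ), Real.exp_mul (Real.log (Real.log (n : ℝ))), Real.exp_log h1,
    Real.rpow_natCast]

lemma aux_pow_eq {a b : ℕ} (ha : 2 ≤ a) (hb : 2 ≤ b) (c : ℕ) :
    ((a : ℝ) / b) ^ c = Real.exp ((c : ℝ) * (Real.log a - Real.log b)) := by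
  have h1 : (0 : ℝ) < a := by positivity
  have h2 : (0 : ℝ) < b := by positivity
  rw [← Real.log_div h1.ne' h2.ne', mul_comm, Real.exp_mul, Real.exp_log (by positivity),
    Real.rpow_natCast]

lemma auxL_up {k N n : ℕ} {σ : ℝ} (hN : 2 ≤ N) (hn : N + 1 ≤ n)
    (hσ : q N * k + (N + 1) ≤ σ) :
    auxL k σ n ≤ auxL k σ N * ((N : ℝ) / n) ^ (N + 1) := by
  rw [auxL_eq (show 2 ≤ n by omega), auxL_eq hN, aux_pow_eq hN (by omega), ← Real.exp_add,
    Real.exp_le_exp]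
  have h := aux_secant_up hN hn
  have l1 := aux_log_lt hN (show N < n by omega)
  have h2 := mul_le_mul_of_nonneg_left h (Nat.cast_nonneg (α := ℝ) k)
  have h3 := mul_le_mul_of_nonneg_right hσ (sub_nonneg.2 l1.le)
  push_cast
  nlinarith

lemma auxL_down {k P n : ℕ} {σ : ℝ} (hn : 2 ≤ n) (hP : n ≤ P)
    (hσ : σ + P ≤ q P * k) :
    auxL k σ n ≤ auxL k σ (P + 1) * ((n : ℝ) / ((P + 1 : ℕ) : ℝ)) ^ P := by
  rw [auxL_eq hn, auxL_eq (show 2 ≤ P + 1 by omega), aux_pow_eq hn (by omega), ← Real.exp_add,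
    Real.exp_le_exp]
  have h := aux_secant_down hn hP
  have l1 := aux_log_lt hn (show n < P + 1 by omega)
  have h2 := mul_le_mul_of_nonneg_left h (Nat.cast_nonneg (α := ℝ) k)
  have h3 := mul_le_mul_of_nonneg_right hσ (sub_nonneg.2 l1.le)
  nlinarith

lemma auxL_tail {k N : ℕ} {σ : ℝ} (hN : 2 ≤ N) (hσ : q N * k + (N + 1) ≤ σ) :
    ∑' i : ℕ, auxL k σ (i + (N + 1)) ≤ auxL k σ N := by
  apply Real.tsum_le_of_sum_range_le (fun _ => auxL_nonneg _ _ _)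
  intro K
  calc ∑ i ∈ range K, auxL k σ (i + (N + 1))
      ≤ ∑ i ∈ range K, auxL k σ N * ((N : ℝ) / ((N + 1 + i : ℕ) : ℝ)) ^ (N + 1) := by
        apply sum_le_sum
        intro i _
        rw [add_comm i]
        exact auxL_up hN (by omega) hσ
    _ = auxL k σ N * ∑ i ∈ range K, ((N : ℝ) / ((N + 1 + i : ℕ) : ℝ)) ^ (N + 1) := by
        rw [mul_sum]
    _ ≤ auxL k σ N * 1 := by
        apply mul_le_mul_of_nonneg_left _ (auxL_nonneg _ _ _)
        have := aux_tail_sum (show 1 ≤ N by omega) K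
        have h : 0 ≤ ((N : ℝ) / ((N + K : ℕ) : ℝ)) ^ N := by positivity
        linarith
    _ = _ := mul_one _

lemma auxL_head {k P : ℕ} {σ : ℝ} (hP : 1 ≤ P) (hk : k ≠ 0)
    (hσ : 2 ≤ P → σ + P ≤ q P * k) :
    ∑ n ∈ range (P + 1), auxL k σ n < auxL k σ (P + 1) := by
  have hpos : 0 < auxL k σ (P + 1) := by
    rw [auxL_eq (by omega)]; exact Real.exp_pos _
  calc ∑ n ∈ range (P + 1), auxL k σ n
      ≤ ∑ n ∈ range (P + 1), auxL k σ (P + 1) * ((n : ℝ) / ((P + 1 : ℕ) : ℝ)) ^ P := by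
        apply sum_le_sum
        intro n hn
        rw [mem_range] at hn
        rcases lt_or_ge n 2 with h | h
        · have : auxL k σ n = 0 := by
            unfold auxL
            interval_cases n <;> simp [hk]
          rw [this]
          positivity
        · exact auxL_down h (by omega) (hσ (by omega))
    _ = auxL k σ (P + 1) * ∑ n ∈ range (P + 1), ((n : ℝ) / ((P + 1 : ℕ) : ℝ)) ^ P := by
        rw [mul_sum]
    _ < auxL k σ (P + 1) * 1 := mul_lt_mul_of_pos_left (aux_head_sum' hP) hpos
    _ = _ := mul_one _

lemma aux_logMul_iter (k n : ℕ) :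
    (LSeries.logMul^[k] (1 : ℕ → ℂ)) n = (Complex.log n) ^ k := by
  induction k with
  | zero => simp
  | succ k ih =>
    rw [Function.iterate_succ', Function.comp_apply, LSeries.logMul, ih, pow_succ']

lemma aux_zeta_deriv (k : ℕ) {s : ℂ} (hs : 1 < s.re) :
    iteratedDeriv k riemannZeta s = (-1) ^ k * LSeries (LSeries.logMul^[k] 1) s := by
  have h : riemannZeta =ᶠ[nhds s] LSeries 1 := by
    filter_upwards [(isOpen_lt continuous_const Complex.continuous_re).mem_nhds hs] with z hz
    exact (LSeries_one_eq_riemannZeta hz).symm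
  rw [h.iteratedDeriv_eq k, LSeries_iteratedDeriv]
  rw [LSeries.abscissaOfAbsConv_one]
  exact_mod_cast hs

lemma aux_norm_term {k : ℕ} (hk : k ≠ 0) (s : ℂ) (n : ℕ) :
    ‖LSeries.term (LSeries.logMul^[k] 1) s n‖ = auxL k s.re n := by
  rw [LSeries.norm_term_eq]
  split_ifs with h
  · simp [auxL, h, hk]
  · rw [aux_logMul_iter, auxL, norm_pow, ← Complex.ofReal_natCast, ← Complex.ofReal_log (by positivity),
      Complex.norm_real, Real.norm_of_nonneg (Real.log_natCast_nonneg n)]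

/-- Two consecutive terms are aligned. -/
lemma aux_aligned {k M : ℕ} (hM : 2 ≤ M) (s : ℂ) (j : ℤ)
    (hs : s.im * (Real.log ((M : ℝ) + 1) - Real.log M) = 2 * Real.pi * j) :
    ‖LSeries.term (LSeries.logMul^[k] 1) s M + LSeries.term (LSeries.logMul^[k] 1) s (M + 1)‖
      = auxL k s.re M + auxL k s.re (M + 1) := by
  have key : ∀ n : ℕ, 2 ≤ n → LSeries.term (LSeries.logMul^[k] 1) s n =
      (auxL k s.re n : ℂ) * Complex.exp (-(s.im * Real.log n : ℝ) * Complex.I) := by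
    intro n hn
    have hn0 : (n : ℂ) ≠ 0 := by exact_mod_cast (show n ≠ 0 by omega)
    have hn1 : (0 : ℝ) < n := by positivity
    rw [LSeries.term_of_ne_zero (by omega), aux_logMul_iter, auxL, Complex.cpow_def_of_ne_zero hn0]
    have e : Complex.log (n : ℂ) = ((Real.log n : ℝ) : ℂ) := by
      rw [← Complex.ofReal_natCast, ← Complex.ofReal_log hn1.le]
    rw [e, Real.rpow_def_of_pos hn1, div_eq_mul_inv, ← Complex.exp_neg]
    push_cast
    rw [div_eq_mul_inv, ← Complex.exp_neg, mul_assoc, ← Complex.exp_add]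
    congr 2
    conv_lhs => rw [← Complex.re_add_im s]
    ring
  have e2 : Complex.exp (-(s.im * Real.log (M + 1 : ℕ) : ℝ) * Complex.I) =
      Complex.exp (-(s.im * Real.log M : ℝ) * Complex.I) := by
    rw [Complex.exp_eq_exp_iff_exists_int]
    refine ⟨-j, ?_⟩
    have : s.im * Real.log (M + 1 : ℕ) = s.im * Real.log M + 2 * Real.pi * j := by
      push_cast; linarith
    rw [this]
    push_cast
    ring
  rw [key M hM, key (M + 1) (by omega), e2, ← add_mul, norm_mul, ← Complex.ofReal_neg,
    Complex.norm_exp_ofReal_mul_I, mul_one, ← Complex.ofReal_add, Complex.norm_real,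
    Real.norm_of_nonneg (add_nonneg (auxL_nonneg _ _ _) (auxL_nonneg _ _ _))]

/-- If the critical strip `S_M^k` exists, then the `k`-th derivative of the Riemann zeta
function has no zeros on the horizontal line segments of `S_M^k` at the heights
`t = 2πj/(log(M+1) - log M)`, `j ∈ ℤ`. -/
theorem zeta_deriv_ne_zero_on_horizontal_segments (M k : ℕ) (hM : 2 ≤ M) (hk : 3 ≤ k)
    (hex : q (M + 1) * k + ((M : ℝ) + 2) * Real.log 3 <
      q M * k - ((M : ℝ) + 1) * Real.log 3)
    (j : ℤ) (σ : ℝ)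
    (h1 : q M * k - ((M : ℝ) + 1) * Real.log 3 ≤ σ)
    (h2 : σ ≤ q M * k + ((M : ℝ) + 1) * Real.log 3) :
    iteratedDeriv k riemannZeta
      ((σ : ℂ) + Complex.I *
        ((2 * Real.pi * (j : ℝ) / (Real.log ((M : ℝ) + 1) - Real.log M) : ℝ) : ℂ)) ≠ 0 := by
  have hlog3 : 1 < Real.log 3 := by
    rw [Real.lt_log_iff_exp_lt (by norm_num)]
    linarith [Real.exp_one_lt_d9]
  have hM0 : (2 : ℝ) ≤ M := by exact_mod_cast hM
  have hk0 : (0 : ℝ) ≤ k := Nat.cast_nonneg k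
  have hkne : k ≠ 0 := by omega
  set s : ℂ := (σ : ℂ) + Complex.I *
        ((2 * Real.pi * (j : ℝ) / (Real.log ((M : ℝ) + 1) - Real.log M) : ℝ) : ℂ) with hs
  have hre : s.re = σ := by simp only [hs, Complex.add_re, Complex.ofReal_re, Complex.I_mul_re, Complex.ofReal_im]; ring
  have him : s.im = 2 * Real.pi * (j : ℝ) / (Real.log ((M : ℝ) + 1) - Real.log M) := by
    simp only [hs, Complex.add_im, Complex.ofReal_re, Complex.I_mul_im, Complex.ofReal_im]; ring
  have hlM : Real.log M < Real.log ((M : ℝ) + 1) :=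
    Real.log_lt_log (by linarith) (by linarith)
  have hq1 : 0 ≤ q (M + 1) * k := mul_nonneg (aux_q_pos (by omega)).le hk0
  have hσN : q (M + 1) * k + (((M + 1 : ℕ) : ℝ) + 1) ≤ σ := by
    push_cast
    nlinarith
  have hσ1 : 1 < σ := by
    push_cast at hσN
    linarith
  obtain ⟨P, rfl⟩ : ∃ P, M = P + 1 := ⟨M - 1, by omega⟩
  have hhead : 2 ≤ P → σ + P ≤ q P * k := by
    intro hP
    have hc := mul_le_mul_of_nonneg_right (aux_q_convex hP) hk0
    simp only [show P + 1 + 1 = P + 2 by omega] at hex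
    push_cast at *
    nlinarith
  have A := auxL_tail (k := k) (show 2 ≤ P + 1 + 1 by omega) hσN
  have B := auxL_head (show 1 ≤ P by omega) hkne hhead
  have C := aux_aligned (k := k) hM s j (by
    rw [him]; exact div_mul_cancel₀ _ (by linarith))
  rw [hre] at C
  rw [aux_zeta_deriv k (by rw [hre]; exact hσ1)]
  refine mul_ne_zero (by simp) ?_
  intro h0
  set f := LSeries.term (LSeries.logMul^[k] (1 : ℕ → ℂ)) s with hf
  have hsum : Summable f := by
    apply LSeriesSummable_of_abscissaOfAbsConv_lt_re
    rw [LSeries.absicssaOfAbsConv_logPowMul, LSeries.abscissaOfAbsConv_one, hre]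
    exact_mod_cast hσ1
  have hnorm : ∀ n, ‖f n‖ = auxL k σ n := fun n => by rw [hf, aux_norm_term hkne, hre]
  rw [LSeries, ← hsum.sum_add_tsum_nat_add (P + 1 + 1 + 1), sum_range_succ, sum_range_succ] at h0
  have e : f (P + 1) + f (P + 1 + 1) =
      -(∑ n ∈ range (P + 1), f n + ∑' i, f (i + (P + 1 + 1 + 1))) := by
    linear_combination h0
  have hsn : Summable (fun i => ‖f (i + (P + 1 + 1 + 1))‖) :=
    (summable_nat_add_iff (f := fun i => ‖f i‖) (P + 1 + 1 + 1)).2 hsum.norm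
  have D : ‖f (P + 1) + f (P + 1 + 1)‖ ≤
      ∑ n ∈ range (P + 1), auxL k σ n + ∑' i, auxL k σ (i + (P + 1 + 1 + 1)) := by
    rw [e, norm_neg]
    refine (norm_add_le _ _).trans (add_le_add ?_ ?_)
    · refine (norm_sum_le _ _).trans (le_of_eq ?_)
      simp only [hnorm]
    · refine (norm_tsum_le_tsum_norm hsn).trans (le_of_eq ?_)
      simp only [hnorm]
  rw [C] at D
  linarith
end
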